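/- arXiv:2310.19048 — 4 statements merged into one kernel-verified Lean document; each statement's English description precedes it below -/
import Mathlib

section
/- Let k ≥ 2 and let G be a C_{2k+1}-free graph whose vertex set is partitioned as V₁ ∪ V₂ with |V₁|, |V₂| ≥ 8k. For i ∈ {1,2} let L_i = {v ∈ V_i : v has at least (1 − 1/(10k))·|V_{3−i}| neighbors in V_{3−i}}, let S_i = V_i ∖ L_i, and suppose |S_i| ≤ |V_i|/(4k) for each i. Then every triangle of G contains a vertex whose degree in G is at most |S₁| + |S₂| + 1. -/
open SimpleGraph

/-- The number of triangles (copies of `K_3`) in `G`. -/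
noncomputable def triangleCount {V : Type*} (G : SimpleGraph V) : ℕ :=
  (G.cliqueSet 3).ncard

/-- The number of edges of `G`. -/
noncomputable def edgeCount {V : Type*} (G : SimpleGraph V) : ℕ :=
  G.edgeSet.ncard

/-- `G` contains a copy of `H` as a (not necessarily induced) subgraph. -/
def Contains {V W : Type*} (G : SimpleGraph V) (H : SimpleGraph W) : Prop :=
  ∃ f : W → V, Function.Injective f ∧ ∀ ⦃i j⦄, H.Adj i j → G.Adj (f i) (f j)

/-- `G` contains `c` pairwise vertex-disjoint copies of the cycle `C_m`. -/
def HasDisjointCycles {V : Type*} (G : SimpleGraph V) (c m : ℕ) : Prop :=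
  ∃ f : Fin c → Fin m → V,
    (∀ j, Function.Injective (f j)) ∧
    (∀ j, ∀ ⦃i i'⦄, (cycleGraph m).Adj i i' → G.Adj (f j i) (f j i')) ∧
    Pairwise fun j j' => Disjoint (Set.range (f j)) (Set.range (f j'))

/-- The join `G ⋈ H`: disjoint union plus all edges between the two sides. -/
def joinGraph {α β : Type*} (G : SimpleGraph α) (H : SimpleGraph β) : SimpleGraph (α ⊕ β) :=
  SimpleGraph.fromRel (fun x y =>
    (∃ a a', x = Sum.inl a ∧ y = Sum.inl a' ∧ G.Adj a a') ∨
    (∃ b b', x = Sum.inr b ∧ y = Sum.inr b' ∧ H.Adj b b') ∨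
    (x.isLeft ∧ y.isRight))

/-- The graph `K_ℓ ⋈ T_2(m)`: the join of a complete graph on `ℓ` vertices with the
complete balanced bipartite (Turán) graph on `m` vertices. -/
noncomputable def extremalJoin (ℓ m : ℕ) : SimpleGraph (Fin ℓ ⊕ Fin m) :=
  joinGraph (completeGraph (Fin ℓ)) (turanGraph m 2)

/-- `heavySet G k A B` is the set `L` of vertices of `A` having at least
`(1 - 1/(10k))·|B|` neighbours in `B`. -/
noncomputable def heavySet {V : Type*} (G : SimpleGraph V) (k : ℕ) (A B : Set V) : Set V :=
  {v ∈ A | ((1 : ℝ) - 1 / (10 * k)) * B.ncard ≤ ((G.neighborSet v ∩ B).ncard : ℝ)}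

/-- A path on `m + 1` vertices whose endpoints are adjacent yields a copy of `C_{m+1}`. -/
theorem contains_cycleGraph_of_isPath {V : Type*} {G : SimpleGraph V} {u w : V}
    (p : G.Walk u w) (hp : p.IsPath) (hadj : G.Adj w u) :
    Contains G (cycleGraph (p.length + 1)) := by
  have hstep : ∀ i j : Fin (p.length + 1), j - i = 1 →
      G.Adj (p.getVert i) (p.getVert j) := by
    intro i j hij
    obtain rfl : j = i + 1 := by rw [← hij]; abel
    rcases eq_or_ne i (Fin.last p.length) with rfl | hi
    · simpa using hadj
    · rw [Fin.val_add_one_of_lt (Fin.lt_last_iff_ne_last.2 hi)]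
      exact p.adj_getVert_succ (Fin.lt_last_iff_ne_last.2 hi)
  refine ⟨fun i => p.getVert i, ?_, ?_⟩
  · intro i j hij
    exact Fin.ext (hp.getVert_injOn (Nat.lt_succ_iff.1 i.2) (Nat.lt_succ_iff.1 j.2) hij)
  · intro i j hij
    rw [cycleGraph_adj'] at hij
    have hval : ∀ a : Fin (p.length + 1), a.val = 1 → a = 1 := by
      intro a ha
      have := a.2
      refine Fin.ext ?_
      rw [ha, Fin.coe_ofNat_eq_mod, Nat.mod_eq_of_lt (by omega)]
    rcases hij with h | h
    · exact (hstep j i (hval _ h)).symm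
    · exact hstep i j (hval _ h)

/-- Any two vertices of `A` have a common neighbour in `B` outside any set of at most `N`
vertices. -/
def RichCommonNeighbors {V : Type*} (G : SimpleGraph V) (N : ℕ) (A B : Set V) : Prop :=
  ∀ u ∈ A, ∀ w ∈ A, ∀ F : Finset V, F.card ≤ N → ∃ x ∈ B, x ∉ F ∧ G.Adj u x ∧ G.Adj w x

/-- Greedy embedding of paths of prescribed length and endpoints, avoiding a small set `F`. -/
theorem exists_isPath_of_richCommonNeighbors {V : Type*} {G : SimpleGraph V} {N : ℕ} {w : V}
    (n : ℕ) : ∀ {A B : Set V}, RichCommonNeighbors G N A B → RichCommonNeighbors G N B A →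
      ∀ u ∈ A, u ≠ w → (Even n → w ∈ A) → (¬ Even n → w ∈ B) →
      ∀ F : Finset V, u ∉ F → w ∉ F → F.card + n + 2 ≤ N →
      ∃ p : G.Walk u w, p.IsPath ∧ p.length = n + 2 ∧
        ∀ x ∈ p.support, x ∈ A ∪ B ∧ x ∉ F := by
  classical
  induction n with
  | zero =>
    intro A B hAB _ u hu huw heven _ F huF hwF hF
    have hw := heven Even.zero
    obtain ⟨x, hxB, hxF, hux, hwx⟩ := hAB u hu w hw F (by omega)
    refine ⟨.cons hux (.cons hwx.symm .nil), ?_, rfl, ?_⟩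
    · simp [Walk.cons_isPath_iff, hux.ne, hwx.ne', huw]
    · simp [hu, hxB, hw, huF, hxF, hwF]
  | succ n ih =>
    intro A B hAB hBA u hu huw heven hodd F huF hwF hF
    obtain ⟨x, hxB, hxF, hux, -⟩ := hAB u hu u hu (insert w F)
      ((Finset.card_insert_le _ _).trans (by omega))
    rw [Finset.mem_insert, not_or] at hxF
    obtain ⟨p, hp, hlen, hsupp⟩ := ih hBA hAB x hxB hxF.1
      (fun h => hodd (by simpa [Nat.even_add_one] using h))
      (fun h => heven (by simpa [Nat.even_add_one] using h)) (insert u F)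
      (by simp [hux.ne', hxF.2]) (by simp [huw.symm, hwF])
      (by have := Finset.card_insert_le u F; omega)
    refine ⟨.cons hux p, ?_, by simp [hlen], ?_⟩
    · rw [Walk.cons_isPath_iff]
      exact ⟨hp, fun h => (hsupp u h).2 (Finset.mem_insert_self _ _)⟩
    · intro y hy
      rw [Walk.support_cons, List.mem_cons] at hy
      rcases hy with rfl | hy
      · exact ⟨Or.inl hu, huF⟩
      · have := hsupp y hy
        rw [Finset.mem_insert, not_or] at this
        exact ⟨this.1.symm, this.2.2⟩

/-- If `A` and `B` have rich common neighbours in each other, then a triangle each of whose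
vertices lies in `A ∪ B` or has at least three neighbours there can be rerouted through `A ∪ B`
into a copy of `C_{2k+1}`. -/
theorem contains_cycleGraph_of_triangle {V : Type*} {G : SimpleGraph V} {k : ℕ} (hk : 2 ≤ k)
    {A B : Set V} (hAB : RichCommonNeighbors G (2 * k) A B)
    (hBA : RichCommonNeighbors G (2 * k) B A) (hdisj : Disjoint A B) {v₁ v₂ v₃ : V}
    (h12 : G.Adj v₁ v₂) (h13 : G.Adj v₁ v₃) (h23 : G.Adj v₂ v₃)
    (hnbr : ∀ z ∈ ({v₁, v₂, v₃} : Set V), z ∉ A ∪ B →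
      ∀ a b, ∃ w ∈ A ∪ B, G.Adj z w ∧ w ≠ a ∧ w ≠ b) :
    Contains G (cycleGraph (2 * k + 1)) := by
  by_contra hfree
  have hne : ∀ {u w}, u ∈ A → w ∈ B → u ≠ w := fun hu hw h =>
    Set.disjoint_left.1 hdisj hu (h ▸ hw)
  have hcyc : ∀ {u w} (p : G.Walk u w), p.IsPath → p.length = 2 * k → ¬ G.Adj w u := by
    intro u w p hp hlen hadj
    exact hfree (hlen ▸ contains_cycleGraph_of_isPath p hp hadj)
  have hsame : ∀ m, 1 ≤ m → m ≤ k → ∀ u w, u ≠ w → (u ∈ A ∧ w ∈ A ∨ u ∈ B ∧ w ∈ B) →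
      ∃ p : G.Walk u w, p.IsPath ∧ p.length = 2 * m ∧ ∀ x ∈ p.support, x ∈ A ∪ B := by
    intro m hm hmk u w huw h
    have he : Even (2 * m - 2) := ⟨m - 1, by omega⟩
    rcases h with ⟨hu, hw⟩ | ⟨hu, hw⟩
    · obtain ⟨p, hp, hl, hs⟩ := exists_isPath_of_richCommonNeighbors (2 * m - 2) hAB hBA u hu
        huw (fun _ => hw) (fun h => absurd he h) ∅ (by simp) (by simp) (by simp; omega)
      exact ⟨p, hp, by omega, fun x hx => (hs x hx).1⟩
    · obtain ⟨p, hp, hl, hs⟩ := exists_isPath_of_richCommonNeighbors (2 * m - 2) hBA hAB u hu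
        huw (fun _ => hw) (fun h => absurd he h) ∅ (by simp) (by simp) (by simp; omega)
      exact ⟨p, hp, by omega, fun x hx => (hs x hx).1.symm⟩
  have hopp : ∀ u w, u ∈ A → w ∈ B →
      ∃ p : G.Walk u w, p.IsPath ∧ p.length = 2 * k - 1 ∧ ∀ x ∈ p.support, x ∈ A ∪ B := by
    intro u w hu hw
    have ho : ¬ Even (2 * k - 3) := by rw [Nat.not_even_iff_odd]; exact ⟨k - 2, by omega⟩
    obtain ⟨p, hp, hl, hs⟩ := exists_isPath_of_richCommonNeighbors (2 * k - 3) hAB hBA u hu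
      (hne hu hw) (fun h => absurd h ho) (fun _ => hw) ∅ (by simp) (by simp) (by simp; omega)
    exact ⟨p, hp, by omega, fun x hx => (hs x hx).1⟩
  have noSameEdge : ∀ u w, G.Adj u w → ¬ (u ∈ A ∧ w ∈ A ∨ u ∈ B ∧ w ∈ B) := by
    intro u w hadj h
    obtain ⟨p, hp, hl, -⟩ := hsame k (by omega) le_rfl u w hadj.ne h
    exact hcyc p hp hl hadj.symm
  have noOppCherry : ∀ u w z, z ∉ A ∪ B → G.Adj z u → G.Adj z w → u ∈ A → w ∉ B := by
    intro u w z hz hzu hzw hu hw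
    obtain ⟨p, hp, hl, hs⟩ := hopp u w hu hw
    refine hcyc (.cons hzu p) ?_ (by rw [Walk.length_cons]; omega) hzw.symm
    rw [Walk.cons_isPath_iff]
    exact ⟨hp, fun h => hz (hs z h)⟩
  have noSameLink : ∀ u w y z, y ∉ A ∪ B → z ∉ A ∪ B → G.Adj y z → G.Adj y u → G.Adj z w →
      u ≠ w → ¬ (u ∈ A ∧ w ∈ A ∨ u ∈ B ∧ w ∈ B) := by
    intro u w y z hy hz hyz hyu hzw huw h
    obtain ⟨p, hp, hl, hs⟩ := hsame (k - 1) (by omega) (by omega) u w huw h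
    refine hcyc (.cons hyz.symm (.cons hyu p)) ?_
      (by rw [Walk.length_cons, Walk.length_cons]; omega) hzw.symm
    rw [Walk.cons_isPath_iff, Walk.cons_isPath_iff, Walk.support_cons, List.mem_cons, not_or]
    exact ⟨⟨hp, fun h => hy (hs y h)⟩, hyz.ne', fun h => hz (hs z h)⟩
  have noTwoHeavy : ∀ x y z, G.Adj x y → G.Adj x z → G.Adj y z → x ∈ A ∪ B → y ∈ A ∪ B →
      z ∉ A ∪ B → False := by
    intro x y z hxy hxz hyz hx hy hz
    have h1 := noSameEdge x y hxy
    have h2 := noOppCherry x y z hz hxz.symm hyz.symm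
    have h3 := noOppCherry y x z hz hyz.symm hxz.symm
    simp only [Set.mem_union] at hx hy
    tauto
  have noOneHeavy : ∀ x y z, G.Adj x y → G.Adj x z → G.Adj y z → x ∈ A ∪ B → y ∉ A ∪ B →
      z ∉ A ∪ B → (∀ a b, ∃ w ∈ A ∪ B, G.Adj y w ∧ w ≠ a ∧ w ≠ b) → False := by
    intro x y z hxy hxz hyz hx hy hz hnb
    obtain ⟨w, hw, hyw, hwx, -⟩ := hnb x x
    have h1 := noSameLink w x y z hy hz hyz hyw hxz.symm hwx
    have h2 := noOppCherry x w y hy hxy.symm hyw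
    have h3 := noOppCherry w x y hy hyw hxy.symm
    simp only [Set.mem_union] at hx hw
    tauto
  have pigeonhole : ∀ a ∈ A ∪ B, ∀ b ∈ A ∪ B, ∀ c ∈ A ∪ B, (a ∈ A ∧ b ∈ A ∨ a ∈ B ∧ b ∈ B) ∨
      (a ∈ A ∧ c ∈ A ∨ a ∈ B ∧ c ∈ B) ∨ (b ∈ A ∧ c ∈ A ∨ b ∈ B ∧ c ∈ B) := by
    rintro a (ha | ha) b (hb | hb) c (hc | hc) <;> simp [ha, hb, hc]
  have n1 := hnbr v₁ (by simp)
  have n2 := hnbr v₂ (by simp)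
  have n3 := hnbr v₃ (by simp)
  by_cases m1 : v₁ ∈ A ∪ B <;> by_cases m2 : v₂ ∈ A ∪ B <;> by_cases m3 : v₃ ∈ A ∪ B
  · have e12 := noSameEdge _ _ h12
    have e13 := noSameEdge _ _ h13
    have e23 := noSameEdge _ _ h23
    exact (pigeonhole _ m1 _ m2 _ m3).elim e12 (Or.elim · e13 e23)
  · exact noTwoHeavy _ _ _ h12 h13 h23 m1 m2 m3
  · exact noTwoHeavy _ _ _ h13 h12 h23.symm m1 m3 m2
  · exact noOneHeavy _ _ _ h12 h13 h23 m1 m2 m3 (n2 m2)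
  · exact noTwoHeavy _ _ _ h23 h12.symm h13.symm m2 m3 m1
  · exact noOneHeavy _ _ _ h12.symm h23 h13 m2 m1 m3 (n1 m1)
  · exact noOneHeavy _ _ _ h13.symm h23.symm h12 m3 m1 m2 (n1 m1)
  · obtain ⟨a, ha, ha1, -, -⟩ := n1 m1 v₁ v₁
    obtain ⟨b, hb, hb2, hba, -⟩ := n2 m2 a a
    obtain ⟨c, hc, hc3, hca, hcb⟩ := n3 m3 a b
    have e12 := noSameLink a b _ _ m1 m2 h12 ha1 hb2 hba.symm
    have e13 := noSameLink a c _ _ m1 m3 h13 ha1 hc3 hca.symm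
    have e23 := noSameLink b c _ _ m2 m3 h23 hb2 hc3 hcb.symm
    exact (pigeonhole _ ha _ hb _ hc).elim e12 (Or.elim · e13 e23)

/-- If few vertices of `B` are not heavy, then any two heavy vertices of `A` have many common
heavy neighbours in `B`. -/
theorem richCommonNeighbors_heavySet {V : Type*} [Finite V] {G : SimpleGraph V} {k : ℕ}
    (hk : 2 ≤ k) {A B : Set V} (hB : 8 * k ≤ B.ncard)
    (hS : ((B \ heavySet G k B A).ncard : ℝ) ≤ (B.ncard : ℝ) / (4 * k)) :
    RichCommonNeighbors G (2 * k) (heavySet G k A B) (heavySet G k B A) := by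
  intro u hu w hw F hF
  by_contra! hcon
  have hcover : B ⊆ (B \ G.neighborSet u) ∪ (B \ G.neighborSet w) ∪
      (B \ heavySet G k B A) ∪ (F : Set V) := by
    intro x hx
    by_contra hx'
    simp only [Set.mem_union, Set.mem_sdiff, hx, true_and, not_or, not_not,
      mem_neighborSet, Finset.mem_coe] at hx'
    exact hcon x hx'.1.2 hx'.2 hx'.1.1.1 hx'.1.1.2
  have hmiss : ∀ v ∈ heavySet G k A B,
      ((B \ G.neighborSet v).ncard : ℝ) ≤ (B.ncard : ℝ) / (10 * k) := by
    intro v hv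
    have h1 := hv.2
    have h2 : ((B ∩ G.neighborSet v).ncard : ℝ) + (B \ G.neighborSet v).ncard = B.ncard := by
      exact_mod_cast Set.ncard_inter_add_ncard_sdiff_eq_ncard B (G.neighborSet v)
    rw [Set.inter_comm] at h1
    have h3 : ((1 : ℝ) - 1 / (10 * k)) * B.ncard = B.ncard - (B.ncard : ℝ) / (10 * k) := by ring
    linarith
  have hle : (B.ncard : ℝ) ≤ (B \ G.neighborSet u).ncard + (B \ G.neighborSet w).ncard +
      (B \ heavySet G k B A).ncard + F.card := by
    have := (Set.ncard_le_ncard hcover).trans (Set.ncard_union_le _ _)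
    have h2 := Set.ncard_union_le ((B \ G.neighborSet u) ∪ (B \ G.neighborSet w))
      (B \ heavySet G k B A)
    have h3 := Set.ncard_union_le (B \ G.neighborSet u) (B \ G.neighborSet w)
    rw [Set.ncard_coe_finset] at this
    exact_mod_cast (by omega)
  have hu' := hmiss u hu
  have hw' := hmiss w hw
  have hk' : (2 : ℝ) ≤ k := by exact_mod_cast hk
  have hB' : (8 * k : ℝ) ≤ B.ncard := by exact_mod_cast hB
  have hF' : (F.card : ℝ) ≤ 2 * k := by exact_mod_cast hF
  have hb : (0 : ℝ) ≤ B.ncard := by positivity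
  have e1 : (B.ncard : ℝ) / (10 * k) ≤ B.ncard / 20 :=
    div_le_div_of_nonneg_left hb (by norm_num) (by linarith)
  have e2 : (B.ncard : ℝ) / (4 * k) ≤ B.ncard / 8 :=
    div_le_div_of_nonneg_left hb (by norm_num) (by linarith)
  linarith

/-- Under the partition assumptions, every triangle of a `C_{2k+1}`-free graph contains a
vertex of degree at most `|S₁| + |S₂| + 1`. -/
theorem stmt_15 (k : ℕ) (hk : 2 ≤ k) {V : Type*} [Fintype V] (G : SimpleGraph V)
    (hfree : ¬ Contains G (cycleGraph (2 * k + 1)))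
    (V₁ V₂ : Set V) (hpart : V₁ ∪ V₂ = Set.univ) (hdisj : Disjoint V₁ V₂)
    (h₁ : 8 * k ≤ V₁.ncard) (h₂ : 8 * k ≤ V₂.ncard)
    (hS₁ : ((V₁ \ heavySet G k V₁ V₂).ncard : ℝ) ≤ (V₁.ncard : ℝ) / (4 * k))
    (hS₂ : ((V₂ \ heavySet G k V₂ V₁).ncard : ℝ) ≤ (V₂.ncard : ℝ) / (4 * k))
    (v₁ v₂ v₃ : V) (h12 : G.Adj v₁ v₂) (h13 : G.Adj v₁ v₃) (h23 : G.Adj v₂ v₃) :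
    ∃ v ∈ ({v₁, v₂, v₃} : Set V),
      (G.neighborSet v).ncard ≤
        (V₁ \ heavySet G k V₁ V₂).ncard + (V₂ \ heavySet G k V₂ V₁).ncard + 1 := by
  by_contra! hdeg
  refine hfree (contains_cycleGraph_of_triangle hk (richCommonNeighbors_heavySet hk h₂ hS₂)
    (richCommonNeighbors_heavySet hk h₁ hS₁)
    (hdisj.mono (fun _ h => h.1) (fun _ h => h.1)) h12 h13 h23 ?_)
  intro z hz hzL a b
  by_contra! hcon
  set S₁ := V₁ \ heavySet G k V₁ V₂
  set S₂ := V₂ \ heavySet G k V₂ V₁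
  have hlight : ∀ x, x ∉ heavySet G k V₁ V₂ ∪ heavySet G k V₂ V₁ → x ∈ S₁ ∪ S₂ := by
    intro x hx
    have hx' : x ∈ V₁ ∪ V₂ := hpart ▸ Set.mem_univ x
    rw [Set.mem_union, not_or] at hx
    exact hx'.imp (fun h => ⟨h, hx.1⟩) (fun h => ⟨h, hx.2⟩)
  have hsub : G.neighborSet z ⊆ ((S₁ ∪ S₂) \ {z}) ∪ {a, b} := by
    intro x hx
    by_cases hxL : x ∈ heavySet G k V₁ V₂ ∪ heavySet G k V₂ V₁
    · by_cases hxa : x = a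
      · simp [hxa]
      · simp [hcon x hxL hx hxa]
    · exact Or.inl ⟨hlight x hxL, (G.ne_of_adj hx).symm⟩
  have hcard := (Set.ncard_le_ncard hsub).trans (Set.ncard_union_le _ _)
  have hz' := Set.ncard_sdiff_singleton_add_one (hlight z hzL)
  have hpair : ({a, b} : Set V).ncard ≤ 2 := by
    simpa using Set.ncard_insert_le a {b}
  have hunion := Set.ncard_union_le S₁ S₂
  have := hdeg z hz
  omega
end

section
/- For all integers ℓ ≥ 1 and k ≥ 1 there exists n₀ such that for all n ≥ n₀: if G is a graph on n vertices containing ℓ+1 distinct vertices v₁, …, v_{ℓ+1} such that each v_j lies in at least n²/(8ℓ(2k+1)) triangles of G, then G contains ℓ+1 pairwise vertex-disjoint copies of the cycle C_{2k+1}. -/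
open SimpleGraph

section DisjointCycles

open Finset

variable {V : Type*} [DecidableEq V] (G : SimpleGraph V)

/-- If each `v j` lies on an `m`-cycle avoiding any given small set of other vertices, then
disjoint cycles can be chosen greedily. -/
lemma hasDisjointCycles_of_avoiding (c m : ℕ) (v : Fin c → V) (hv : Function.Injective v)
    (h : ∀ j, ∀ S : Finset V, #S ≤ c * m + c → v j ∉ S →
      ∃ f : Fin m → V, Function.Injective f ∧
        (∀ ⦃i i'⦄, (cycleGraph m).Adj i i' → G.Adj (f i) (f i')) ∧ ∀ i, f i ∉ S) :
    HasDisjointCycles G c m := by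
  have key : ∀ a ≤ c, ∃ f : Fin c → Fin m → V,
      (∀ j, j.val < a → Function.Injective (f j)) ∧
      (∀ j, j.val < a → ∀ ⦃i i'⦄, (cycleGraph m).Adj i i' → G.Adj (f j i) (f j i')) ∧
      (∀ j j', j.val < a → j'.val < j.val → ∀ i i', f j i ≠ f j' i') ∧
      ∀ j j', j.val < a → a ≤ j'.val → ∀ i, f j i ≠ v j' := by
    intro a
    induction a with
    | zero => exact fun _ => ⟨fun j _ => v j, by simp⟩
    | succ a ih =>
      intro ha
      obtain ⟨f, hinj, hadj, hdisj, hav⟩ := ih (by omega)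
      let b : Fin c := ⟨a, ha⟩
      let S : Finset V := ((univ.filter fun j : Fin c => j.val < a) ×ˢ univ).image
        (fun q : Fin c × Fin m => f q.1 q.2) ∪ (univ.erase b).image v
      have hS : #S ≤ c * m + c := by
        refine (card_union_le _ _).trans (Nat.add_le_add (card_image_le.trans ?_)
          (card_image_le.trans ?_))
        · exact (card_le_univ _).trans (by simp)
        · exact (card_le_univ _).trans (by simp)
      have hbS : v b ∉ S := by
        simp only [S, mem_union, mem_image, mem_product, mem_filter, mem_univ, true_and, and_true,
          mem_erase, not_or, not_exists, not_and]
        exact ⟨fun q hq => hav q.1 b hq le_rfl q.2, fun j hj hjb => hj (hv hjb)⟩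
      obtain ⟨g, ginj, gadj, gS⟩ := h b S hS hbS
      have hgf : ∀ j, j.val < a → ∀ i i', g i ≠ f j i' := fun j hj i i' hij =>
        gS i (mem_union_left _ (mem_image.2 ⟨(j, i'), by simp [hj], hij.symm⟩))
      have hgv : ∀ j, j ≠ b → ∀ i, g i ≠ v j := fun j hj i hij =>
        gS i (mem_union_right _ (mem_image.2 ⟨j, by simp [hj], hij.symm⟩))
      have hcase : ∀ j : Fin c, j.val < a + 1 → j = b ∨ (j ≠ b ∧ j.val < a) := by
        intro j hj
        by_cases hjb : j = b
        · exact Or.inl hjb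
        · have : j.val ≠ a := fun hja => hjb (Fin.ext hja)
          exact Or.inr ⟨hjb, by omega⟩
      refine ⟨Function.update f b g, ?_, ?_, ?_, ?_⟩
      · intro j hj
        rcases hcase j hj with rfl | ⟨hjb, hj⟩
        · simpa using ginj
        · simpa [hjb] using hinj j hj
      · intro j hj
        rcases hcase j hj with rfl | ⟨hjb, hj⟩
        · simpa using gadj
        · simpa [hjb] using hadj j hj
      · intro j j' hj hj'
        have hj'b : j' ≠ b := fun hb => by
          have : j'.val = a := congrArg Fin.val hb
          omega
        rcases hcase j hj with rfl | ⟨hjb, hj⟩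
        · simpa [hj'b] using hgf j' hj'
        · simpa [hjb, hj'b] using hdisj j j' hj hj'
      · intro j j' hj hj'
        have hj'b : j' ≠ b := fun hb => by
          have : j'.val = a := congrArg Fin.val hb
          omega
        rcases hcase j hj with rfl | ⟨hjb, hj⟩
        · simpa using hgv j' hj'b
        · simpa [hjb] using hav j j' hj (by omega)
  obtain ⟨f, hinj, hadj, hdisj, -⟩ := key c le_rfl
  refine ⟨f, fun j => hinj j j.isLt, fun j => hadj j j.isLt, fun j j' hjj => Set.disjoint_left.2 ?_⟩
  rintro _ ⟨i, rfl⟩ ⟨e, he⟩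
  rcases lt_or_gt_of_ne hjj with hlt | hlt
  · exact hdisj j' j j'.isLt hlt e i he
  · exact hdisj j j' j.isLt hlt i e he.symm

variable [DecidableRel G.Adj]

/-- The ordered pairs of adjacent vertices inside `W`. -/
def adjPairs (W : Finset V) : Finset (V × V) :=
  (W ×ˢ W).filter fun p => G.Adj p.1 p.2

/-- Deleting `x` destroys at most two ordered adjacent pairs for each neighbour of `x`. -/
lemma card_adjPairs_le_erase (W : Finset V) (x : V) :
    #(adjPairs G W) ≤ #(adjPairs G (W.erase x)) + 2 * #(W.filter (G.Adj x)) := by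
  have hsub : adjPairs G W ⊆ adjPairs G (W.erase x) ∪
      ((W.filter (G.Adj x)).image (fun y => (x, y)) ∪
        (W.filter (G.Adj x)).image (fun y => (y, x))) := by
    rintro ⟨a, b⟩ h
    simp only [adjPairs, mem_filter, mem_product, mem_union, mem_erase, mem_image,
      Prod.mk.injEq] at h ⊢
    by_cases ha : a = x
    · subst ha
      exact Or.inr (Or.inl ⟨b, ⟨h.1.2, h.2⟩, rfl, rfl⟩)
    · by_cases hb : b = x
      · subst hb
        exact Or.inr (Or.inr ⟨a, ⟨h.1.1, h.2.symm⟩, rfl, rfl⟩)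
      · exact Or.inl ⟨⟨⟨ha, h.1.1⟩, hb, h.1.2⟩, h.2⟩
  have h₁ := card_le_card hsub
  have h₂ := card_union_le (adjPairs G (W.erase x))
    ((W.filter (G.Adj x)).image (fun y => (x, y)) ∪ (W.filter (G.Adj x)).image (fun y => (y, x)))
  have h₃ := card_union_le ((W.filter (G.Adj x)).image (fun y => (x, y)))
    ((W.filter (G.Adj x)).image (fun y => (y, x)))
  have h₄ := card_image_le (s := W.filter (G.Adj x)) (f := fun y => (x, y))
  have h₅ := card_image_le (s := W.filter (G.Adj x)) (f := fun y => (y, x))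
  omega

lemma card_adjPairs_le_sdiff [Fintype V] (W S : Finset V) :
    #(adjPairs G W) ≤ #(adjPairs G (W \ S)) + 2 * (#S * Fintype.card V) := by
  induction S using Finset.induction_on with
  | empty => simp
  | insert x S hx ih =>
    have h := card_adjPairs_le_erase G (W \ S) x
    have h' : #((W \ S).filter (G.Adj x)) ≤ Fintype.card V := card_le_univ _
    rw [sdiff_insert, card_insert_of_notMem hx, add_mul]
    omega

/-- A graph of large average degree contains a nonempty subgraph of large minimum degree. -/
lemma exists_subset_minDegree (d : ℕ) (W : Finset V) (hW : 2 * d * #W < #(adjPairs G W)) :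
    ∃ U ⊆ W, U.Nonempty ∧ ∀ x ∈ U, d < #(U.filter (G.Adj x)) := by
  induction W using Finset.strongInduction with
  | H W ih =>
    by_cases h : ∀ x ∈ W, d < #(W.filter (G.Adj x))
    · refine ⟨W, Subset.rfl, ?_, h⟩
      rw [nonempty_iff_ne_empty]
      rintro rfl
      simp [adjPairs] at hW
    · push Not at h
      obtain ⟨x, hx, hd⟩ := h
      have hle := card_adjPairs_le_erase G W x
      have hcard := card_erase_add_one hx
      obtain ⟨U, hU, hdeg⟩ := ih (W.erase x) (erase_ssubset hx) (by
        rw [← hcard, mul_add] at hW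
        omega)
      exact ⟨U, hU.trans (erase_subset _ _), hdeg⟩

/-- If every vertex of `insert v U` has more than `d` neighbours in `U`, then a path with `d`
edges starts at `v` and otherwise stays in `U`. -/
lemma exists_path_of_minDegree (d : ℕ) (v : V) (U : Finset V)
    (hU : ∀ x ∈ insert v U, d < #(U.filter (G.Adj x))) (m : ℕ) (hm : m ≤ d) :
    ∃ p : ℕ → V, p 0 = v ∧ (∀ i, 1 ≤ i → i ≤ m → p i ∈ U) ∧
      (∀ i j, i ≤ m → j ≤ m → p i = p j → i = j) ∧ ∀ i < m, G.Adj (p i) (p (i + 1)) := by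
  induction m with
  | zero => exact ⟨fun _ => v, rfl, by omega, by omega, by omega⟩
  | succ m ih =>
    obtain ⟨p, h0, hpU, hinj, hadj⟩ := ih (by omega)
    have hmem : p m ∈ insert v U := by
      rcases Nat.eq_zero_or_pos m with rfl | hpos
      · simp [h0]
      · exact mem_insert_of_mem (hpU m hpos le_rfl)
    have hcard : #((range (m + 1)).image p) < #(U.filter (G.Adj (p m))) :=
      (card_image_le.trans (by simpa using hm)).trans_lt (hU _ hmem)
    obtain ⟨y, hy, hyp⟩ := exists_mem_notMem_of_card_lt_card hcard
    rw [mem_filter] at hy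
    have hyp' : ∀ i ≤ m, p i ≠ y := fun i hi h =>
      hyp (mem_image.2 ⟨i, mem_range.2 (by omega), h⟩)
    refine ⟨fun i => if i ≤ m then p i else y, by simp [h0], ?_, ?_, ?_⟩
    · intro i hi _
      by_cases h : i ≤ m
      · simpa [h] using hpU i hi h
      · simpa [h] using hy.1
    · intro i j hi hj hij
      by_cases h : i ≤ m <;> by_cases h' : j ≤ m <;> simp only [h, h', if_true, if_false] at hij
      · exact hinj i j h h' hij
      · exact absurd hij (hyp' i h)
      · exact absurd hij.symm (hyp' j h')
      · omega
    · intro i hi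
      rcases Nat.lt_succ_iff_lt_or_eq.1 hi with h | rfl
      · simpa [h.le, Nat.succ_le_of_lt h] using hadj i h
      · simpa using hy.2

/-- A vertex whose neighbourhood outside `S` spans many edges lies on a cycle avoiding `S`. -/
lemma exists_cycle_of_card_adjPairs [Fintype V] (d : ℕ) (v : V) (S : Finset V)
    (hvS : v ∉ S)
    (h : 2 * d * Fintype.card V < #(adjPairs G (G.neighborFinset v \ S))) :
    ∃ f : Fin (d + 1) → V, Function.Injective f ∧
      (∀ ⦃i i'⦄, (cycleGraph (d + 1)).Adj i i' → G.Adj (f i) (f i')) ∧ ∀ i, f i ∉ S := by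
  obtain ⟨U, hUW, ⟨u, hu⟩, hdeg⟩ := exists_subset_minDegree G d (G.neighborFinset v \ S)
    ((Nat.mul_le_mul_left _ (card_le_univ _)).trans_lt h)
  have hUv : ∀ x ∈ U, G.Adj v x := fun x hx => by simpa using (mem_sdiff.1 (hUW hx)).1
  obtain ⟨p, h0, hpU, hinj, hadj⟩ := exists_path_of_minDegree G d v U
    (by
      intro x hx
      rcases mem_insert.1 hx with rfl | hx
      · refine (hdeg u hu).trans_le (card_le_card fun y hy => ?_)
        have hy' := (mem_filter.1 hy).1
        exact mem_filter.2 ⟨hy', hUv y hy'⟩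
      · exact hdeg x hx) d le_rfl
  have hstep : ∀ i i' : Fin (d + 1), (i' - i).val = 1 → G.Adj (p i) (p i') := by
    intro i i' hii
    rw [Fin.sub_def] at hii
    have hi := i.isLt
    have hi' := i'.isLt
    simp only at hii
    rcases Nat.lt_or_ge i'.val i.val with hlt | hge
    · rw [Nat.mod_eq_of_lt (by omega)] at hii
      have hi0 : i'.val = 0 := by omega
      rw [hi0, h0]
      exact (hUv _ (hpU i (by omega) (by omega))).symm
    · rw [show d + 1 - i.val + i'.val = (i'.val - i.val) + (d + 1) by omega,
        Nat.add_mod_right, Nat.mod_eq_of_lt (by omega)] at hii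
      rw [show i'.val = i.val + 1 by omega]
      exact hadj i (by omega)
  refine ⟨fun i => p i, fun i j hij => Fin.ext (hinj _ _ (by omega) (by omega) hij), ?_, ?_⟩
  · intro i i' hii
    rcases cycleGraph_adj'.1 hii with h | h
    · exact (hstep _ _ h).symm
    · exact hstep _ _ h
  · intro i
    rcases Nat.eq_zero_or_pos i.val with hi | hi
    · simpa [hi, h0] using hvS
    · exact (mem_sdiff.1 (hUW (hpU i hi (by omega)))).2

/-- The number of triangles at `v` is at most the number of ordered pairs of adjacent
neighbours of `v`. -/
lemma ncard_triangles_le_card_adjPairs [Fintype V] (v : V) :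
    {t ∈ G.cliqueSet 3 | v ∈ t}.ncard ≤ #(adjPairs G (G.neighborFinset v)) := by
  have hsub : {t ∈ G.cliqueSet 3 | v ∈ t} ⊆
      (((adjPairs G (G.neighborFinset v)).image fun p => {v, p.1, p.2} : Finset (Finset V)) :
        Set (Finset V)) := by
    rintro t ⟨ht, hvt⟩
    rw [mem_cliqueSet_iff] at ht
    have hcard : #(t.erase v) = 2 := by rw [card_erase_of_mem hvt, ht.card_eq]
    obtain ⟨x, y, hxy, ht'⟩ := card_eq_two.1 hcard
    have hx : x ∈ t.erase v := by simp [ht']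
    have hy : y ∈ t.erase v := by simp [ht']
    rw [mem_erase] at hx hy
    rw [mem_coe, mem_image]
    refine ⟨(x, y), ?_, by rw [← insert_erase hvt, ht']⟩
    simp only [adjPairs, mem_filter, mem_product, mem_neighborFinset]
    exact ⟨⟨ht.isClique hvt hx.2 hx.1.symm, ht.isClique hvt hy.2 hy.1.symm⟩,
      ht.isClique hx.2 hy.2 hxy⟩
  refine (Set.ncard_le_ncard hsub (finite_toSet _)).trans ?_
  rw [Set.ncard_coe_finset]
  exact card_image_le

end DisjointCycles

/-- For sufficiently large `n`: if an `n`-vertex graph has `ℓ+1` distinct vertices each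
lying in at least `n²/(8ℓ(2k+1))` triangles, then it contains `ℓ+1` pairwise
vertex-disjoint copies of `C_{2k+1}`. -/
theorem stmt_16 (ℓ k : ℕ) (hℓ : 1 ≤ ℓ) (hk : 1 ≤ k) :
    ∃ n₀ : ℕ, ∀ n : ℕ, n₀ ≤ n →
      ∀ (V : Type) [Fintype V] (G : SimpleGraph V), Fintype.card V = n →
        ∀ v : Fin (ℓ + 1) → V, Function.Injective v →
          (∀ j, (n : ℝ) ^ 2 / (8 * ℓ * (2 * k + 1)) ≤
              ({t ∈ G.cliqueSet 3 | v j ∈ t}.ncard : ℝ)) →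
          HasDisjointCycles G (ℓ + 1) (2 * k + 1) := by
  classical
  set c := (ℓ + 1) * (2 * k + 1) + (ℓ + 1) with hc
  refine ⟨8 * ℓ * (2 * k + 1) * (2 * (2 * k) + 2 * c) + 1, ?_⟩
  intro n hn V _ G hV v hv htri
  refine hasDisjointCycles_of_avoiding G (ℓ + 1) (2 * k + 1) v hv fun j S hS hvS =>
    exists_cycle_of_card_adjPairs G (2 * k) (v j) S hvS ?_
  have hℓ' : (1 : ℝ) ≤ ℓ := by exact_mod_cast hℓ
  have hn' : (8 * ℓ * (2 * k + 1) * (2 * (2 * k) + 2 * c) + 1 : ℝ) ≤ n := by exact_mod_cast hn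
  have hpos : (0 : ℝ) < 8 * ℓ * (2 * k + 1) := by positivity
  have hnpos : (0 : ℝ) < n := lt_of_lt_of_le (by positivity) hn'
  have hlarge : ((2 * (2 * k) + 2 * c) * n : ℝ) < (n : ℝ) ^ 2 / (8 * ℓ * (2 * k + 1)) := by
    rw [lt_div_iff₀ hpos, sq]
    calc ((2 * (2 * k) + 2 * c) * n * (8 * ℓ * (2 * k + 1)) : ℝ)
        = (8 * ℓ * (2 * k + 1) * (2 * (2 * k) + 2 * c)) * n := by ring
      _ < n * n := by gcongr; linarith
  have hcount : (2 * (2 * k) + 2 * c) * n < (adjPairs G (G.neighborFinset (v j))).card := by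
    have h := (hlarge.trans_le (htri j)).trans_le
      (Nat.cast_le.2 (ncard_triangles_le_card_adjPairs G (v j)))
    exact_mod_cast h
  have hdel := card_adjPairs_le_sdiff G (G.neighborFinset (v j)) S
  rw [hV] at hdel ⊢
  have hSn : S.card * n ≤ c * n := Nat.mul_le_mul_right n hS
  linarith
end

section
/- For all integers ℓ ≥ 1 and k ≥ 1 there exists n₀ such that for all n ≥ n₀: if G is a graph on n vertices containing no ℓ+1 pairwise vertex-disjoint copies of C_{2k+1}, and L is a set of ℓ vertices of G each of which lies in at least n²/(8ℓ(2k+1)) triangles of G, then the induced subgraph G − L on V(G) ∖ L is C_{2k+1}-free. -/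
open SimpleGraph

open Finset in
/-- A symmetric relation with more than `2 * m * #W` related ordered pairs inside `W` has a
nonempty subset of `W` in which every vertex has more than `m` related vertices. -/
lemma exists_subset_large_min_degree {V : Type*} [DecidableEq V] (R : V → V → Prop)
    [DecidableRel R] (hR : ∀ ⦃x y⦄, R x y → R y x) (m : ℕ) (W : Finset V)
    (h : 2 * m * #W < #{p ∈ W ×ˢ W | R p.1 p.2}) :
    ∃ U ⊆ W, U.Nonempty ∧ ∀ x ∈ U, m < #{y ∈ U | R x y} := by
  induction W using Finset.strongInduction with
  | H W ih =>
    by_cases hmin : ∀ x ∈ W, m < #{y ∈ W | R x y}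
    · refine ⟨W, Subset.rfl, ?_, hmin⟩
      rw [nonempty_iff_ne_empty]
      rintro rfl
      simp at h
    · push Not at hmin
      obtain ⟨x, hx, hdeg⟩ := hmin
      have hsub : {p ∈ W ×ˢ W | R p.1 p.2} ⊆
          {p ∈ W.erase x ×ˢ W.erase x | R p.1 p.2} ∪
            (({y ∈ W | R x y}.image fun y => (x, y)) ∪
              ({y ∈ W | R x y}.image fun y => (y, x))) := by
        rintro ⟨a, b⟩ hab
        simp only [mem_filter, mem_product] at hab
        obtain ⟨⟨ha, hb⟩, hr⟩ := hab
        simp only [mem_union, mem_filter, mem_product, mem_erase, mem_image, Prod.mk.injEq]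
        by_cases hax : a = x
        · subst hax
          exact Or.inr (Or.inl ⟨b, ⟨hb, hr⟩, rfl, rfl⟩)
        · by_cases hbx : b = x
          · subst hbx
            exact Or.inr (Or.inr ⟨a, ⟨ha, hR hr⟩, rfl, rfl⟩)
          · exact Or.inl ⟨⟨⟨hax, ha⟩, hbx, hb⟩, hr⟩
      have hcard := (card_le_card hsub).trans (card_union_le _ _)
      have hunion := card_union_le ({y ∈ W | R x y}.image fun y => (x, y))
        ({y ∈ W | R x y}.image fun y => (y, x))
      have hleft := card_image_le (s := {y ∈ W | R x y}) (f := fun y => (x, y))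
      have hright := card_image_le (s := {y ∈ W | R x y}) (f := fun y => (y, x))
      have herase := card_erase_add_one hx
      obtain ⟨U, hU, hne⟩ := ih (W.erase x) (erase_ssubset hx) (by
        rw [← herase, mul_add] at h
        omega)
      exact ⟨U, hU.trans (erase_subset x W), hne⟩

open Finset in
/-- If every vertex of a nonempty set `U` has more than `m` related vertices in `U`, then `U`
contains a path on `j + 1` vertices for every `j ≤ m`. -/
lemma exists_path_of_min_degree {V : Type*} [DecidableEq V] (R : V → V → Prop)
    [DecidableRel R] (m : ℕ) (U : Finset V) (hne : U.Nonempty)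
    (hdeg : ∀ x ∈ U, m < #{y ∈ U | R x y}) (j : ℕ) (hj : j ≤ m) :
    ∃ p : ℕ → V, (∀ i ≤ j, p i ∈ U) ∧ (∀ a ≤ j, ∀ b ≤ j, p a = p b → a = b) ∧
      ∀ i < j, R (p i) (p (i + 1)) := by
  induction j with
  | zero =>
    obtain ⟨x, hx⟩ := hne
    exact ⟨fun _ => x, fun _ _ => hx, by omega, by omega⟩
  | succ j ih =>
    obtain ⟨p, hpU, hinj, hadj⟩ := ih (by omega)
    obtain ⟨y, hy, hnew⟩ : ∃ y ∈ {y ∈ U | R (p j) y}, y ∉ (range (j + 1)).image p := by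
      apply exists_mem_notMem_of_card_lt_card
      calc #((range (j + 1)).image p) ≤ j + 1 := by simpa using card_image_le (s := range (j + 1))
        _ ≤ m := hj
        _ < _ := hdeg _ (hpU j le_rfl)
    simp only [mem_filter] at hy
    have hnew' : ∀ i ≤ j, p i ≠ y := fun i hi heq =>
      hnew (mem_image.2 ⟨i, by simpa [Nat.lt_succ_iff] using hi, heq⟩)
    refine ⟨fun i => if i ≤ j then p i else y, ?_, ?_, ?_⟩
    · intro i _
      dsimp only
      split_ifs with h
      exacts [hpU i h, hy.1]
    · intro a ha b hb hab
      dsimp only at hab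
      split_ifs at hab with h₁ h₂ h₂
      · exact hinj a h₁ b h₂ hab
      · exact absurd hab (hnew' a h₁)
      · exact absurd hab.symm (hnew' b h₂)
      · omega
    · intro i hi
      by_cases h : i + 1 ≤ j
      · simpa [h, (by omega : i ≤ j)] using hadj i h
      · obtain rfl : i = j := by omega
        simpa using hy.2

/-- Consecutive vertices of a cycle graph differ by one, or are the two ends. -/
lemma cycleGraph_adj_val {n : ℕ} {i j : Fin n} (h : (cycleGraph n).Adj i j) :
    (j.val = i.val + 1 ∨ (j.val = 0 ∧ i.val + 1 = n)) ∨
      (i.val = j.val + 1 ∨ (i.val = 0 ∧ j.val + 1 = n)) := by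
  have key : ∀ a b : Fin n, (a - b).val = 1 →
      a.val = b.val + 1 ∨ (a.val = 0 ∧ b.val + 1 = n) := by
    intro a b hab
    have ha := a.isLt
    have hb := b.isLt
    rw [Fin.sub_def] at hab
    dsimp only at hab
    rcases le_or_gt b.val a.val with hle | hlt
    · rw [show n - b.val + a.val = (a.val - b.val) + n by omega, Nat.add_mod_right,
        Nat.mod_eq_of_lt (by omega)] at hab
      omega
    · rw [Nat.mod_eq_of_lt (by omega)] at hab
      omega
  rw [cycleGraph_adj'] at h
  exact h.symm.imp (key j i) (key i j)

open Finset in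
/-- The triangles at `v` are at most as many as the ordered adjacent pairs of neighbours. -/
lemma ncard_triangles_le_card_link {V : Type*} [Fintype V] [DecidableEq V] (G : SimpleGraph V)
    [DecidableRel G.Adj] (v : V) :
    {t ∈ G.cliqueSet 3 | v ∈ t}.ncard ≤
      #{p ∈ (univ : Finset V) ×ˢ (univ : Finset V) |
        G.Adj v p.1 ∧ G.Adj v p.2 ∧ G.Adj p.1 p.2} := by
  have hsub : {t ∈ G.cliqueSet 3 | v ∈ t} ⊆
      ((({p ∈ (univ : Finset V) ×ˢ (univ : Finset V) |
        G.Adj v p.1 ∧ G.Adj v p.2 ∧ G.Adj p.1 p.2}).image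
          fun p => ({v, p.1, p.2} : Finset V) : Finset (Finset V)) : Set (Finset V)) := by
    rintro t ⟨ht, hv⟩
    rw [mem_cliqueSet_iff, is3Clique_iff] at ht
    obtain ⟨a, b, c, hab, hac, hbc, rfl⟩ := ht
    simp only [coe_image, Set.mem_image, mem_coe, mem_filter, mem_product, mem_univ, true_and]
    simp only [mem_insert, mem_singleton] at hv
    rcases hv with rfl | rfl | rfl
    · exact ⟨(b, c), ⟨hab, hac, hbc⟩, rfl⟩
    · exact ⟨(a, c), ⟨hab.symm, hbc, hac⟩, by ext x; simp; tauto⟩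
    · exact ⟨(a, b), ⟨hac.symm, hbc.symm, hab⟩, by ext x; simp; tauto⟩
  calc _ ≤ _ := Set.ncard_le_ncard hsub (finite_toSet _)
    _ ≤ _ := by
      rw [Set.ncard_coe_finset]
      exact card_image_le

open Finset in
/-- A vertex in many triangles lies on a cycle of length `2 * k + 1` avoiding a given small set. -/
lemma exists_cycle_through_avoiding {V : Type*} [Fintype V] [DecidableEq V] (G : SimpleGraph V)
    (k : ℕ) (hk : 1 ≤ k) (v : V) (S : Finset V) (hv : v ∉ S)
    (h : (4 * k + 2 * #S) * Fintype.card V < {t ∈ G.cliqueSet 3 | v ∈ t}.ncard) :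
    ∃ f : Fin (2 * k + 1) → V, Function.Injective f ∧
      (∀ ⦃i j⦄, (cycleGraph (2 * k + 1)).Adj i j → G.Adj (f i) (f j)) ∧ ∀ i, f i ∉ S := by
  classical
  let R : V → V → Prop := fun x y => G.Adj v x ∧ G.Adj v y ∧ G.Adj x y
  have hR : ∀ ⦃x y⦄, R x y → R y x := fun x y hxy => ⟨hxy.2.1, hxy.1, hxy.2.2.symm⟩
  have hsub : {p ∈ (univ : Finset V) ×ˢ (univ : Finset V) | R p.1 p.2} ⊆
      {p ∈ Sᶜ ×ˢ Sᶜ | R p.1 p.2} ∪ (S ×ˢ univ ∪ univ ×ˢ S) := by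
    rintro ⟨a, b⟩ hab
    simp only [mem_filter, mem_product, mem_univ, true_and, mem_union, mem_compl, and_true]
      at hab ⊢
    tauto
  have hcard := (card_le_card hsub).trans (card_union_le _ _)
  have hunion := card_union_le (S ×ˢ (univ : Finset V)) ((univ : Finset V) ×ˢ S)
  simp only [card_product, card_univ] at hunion
  have htri := ncard_triangles_le_card_link G v
  have hcompl : 2 * (2 * k - 1) * #Sᶜ ≤ 4 * k * Fintype.card V :=
    Nat.mul_le_mul (by omega) (card_le_univ _)
  obtain ⟨U, hU, hne, hdeg⟩ := exists_subset_large_min_degree R hR (2 * k - 1) Sᶜ (by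
    change _ ≤ #{p ∈ (univ : Finset V) ×ˢ (univ : Finset V) | R p.1 p.2} at htri
    nlinarith)
  obtain ⟨p, hpU, hinj, hadj⟩ := exists_path_of_min_degree R _ U hne hdeg _ le_rfl
  have hlink : ∀ i ≤ 2 * k - 1, G.Adj v (p i) := by
    intro i hi
    rcases Nat.lt_or_ge i (2 * k - 1) with hlt | hge
    · exact (hadj i hlt).1
    · obtain ⟨j, rfl⟩ : ∃ j, i = j + 1 := ⟨i - 1, by omega⟩
      exact (hadj j (by omega)).2.1
  let g : ℕ → V := fun i => if i = 0 then v else p (i - 1)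
  have hstep : ∀ a b : ℕ, a < 2 * k + 1 → b < 2 * k + 1 →
      (b = a + 1 ∨ (b = 0 ∧ a + 1 = 2 * k + 1)) → G.Adj (g a) (g b) := by
    rintro a b ha hb (rfl | ⟨rfl, ha'⟩)
    · rcases a with _ | a
      · simpa [g] using hlink 0 (by omega)
      · simpa [g] using (hadj a (by omega)).2.2
    · obtain ⟨a, rfl⟩ : ∃ b, a = b + 1 := ⟨a - 1, by omega⟩
      simpa [g] using (hlink a (by omega)).symm
  refine ⟨fun i => g i, ?_, ?_, ?_⟩
  · intro i j hij
    have hi := i.isLt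
    have hj := j.isLt
    apply Fin.ext
    simp only [g] at hij
    split_ifs at hij with h₁ h₂ h₂
    · omega
    · exact absurd hij (hlink _ (by omega)).ne
    · exact absurd hij.symm (hlink _ (by omega)).ne
    · have := hinj _ (by omega) _ (by omega) hij
      omega
  · intro i j hij
    rcases cycleGraph_adj_val hij with h' | h'
    · exact hstep _ _ i.isLt j.isLt h'
    · exact (hstep _ _ j.isLt i.isLt h').symm
  · intro i
    have hi := i.isLt
    simp only [g]
    split_ifs with h₁
    · exact hv
    · exact mem_compl.1 (hU (hpU _ (by omega)))

open Finset in
/-- Disjoint odd cycles avoiding a set `T` of vertices in many triangles can be extended by one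
further disjoint cycle for each vertex of `T`. -/
lemma hasDisjointCycles_add_card {V : Type*} [Fintype V] [DecidableEq V] (G : SimpleGraph V)
    (k : ℕ) (hk : 1 ≤ k) (T : Finset V) (c : ℕ) (f : Fin c → Fin (2 * k + 1) → V)
    (hinj : ∀ j, Function.Injective (f j))
    (hadj : ∀ j, ∀ ⦃i i'⦄, (cycleGraph (2 * k + 1)).Adj i i' → G.Adj (f j i) (f j i'))
    (hdisj : Pairwise fun j j' => Disjoint (Set.range (f j)) (Set.range (f j')))
    (hT : ∀ j i, f j i ∉ T)
    (h : ∀ v ∈ T, (4 * k + 2 * ((c + #T) * (2 * k + 1))) * Fintype.card V <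
      {t ∈ G.cliqueSet 3 | v ∈ t}.ncard) :
    HasDisjointCycles G (c + #T) (2 * k + 1) := by
  induction T using Finset.induction_on generalizing c with
  | empty => exact ⟨f, hinj, hadj, hdisj⟩
  | insert v T hv ih =>
    rw [card_insert_of_notMem hv] at h ⊢
    rw [show c + (#T + 1) = c + 1 + #T by omega] at h ⊢
    let S : Finset V := T ∪ univ.image fun q : Fin c × Fin (2 * k + 1) => f q.1 q.2
    have hS : #S ≤ (c + 1 + #T) * (2 * k + 1) := by
      have h₁ := card_union_le T (univ.image fun q : Fin c × Fin (2 * k + 1) => f q.1 q.2)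
      have h₂ := card_image_le (s := univ) (f := fun q : Fin c × Fin (2 * k + 1) => f q.1 q.2)
      simp only [card_univ, Fintype.card_prod, Fintype.card_fin] at h₂
      change #S ≤ _ at h₁
      nlinarith [Nat.zero_le (#T * k)]
    have hvS : v ∉ S := by
      simp only [S, mem_union, mem_image, mem_univ, true_and, Prod.exists, not_or, not_exists]
      exact ⟨hv, fun a b hab => hT a b (hab ▸ mem_insert_self v T)⟩
    obtain ⟨g, hginj, hgadj, hgS⟩ := exists_cycle_through_avoiding G k hk v S hvS
      (lt_of_le_of_lt (Nat.mul_le_mul_right _ (by omega)) (h v (mem_insert_self v T)))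
    have hgf : ∀ j, Disjoint (Set.range g) (Set.range (f j)) := by
      intro j
      rw [Set.disjoint_left]
      rintro _ ⟨a, rfl⟩ ⟨b, hb⟩
      exact hgS a (mem_union_right _ (mem_image.2 ⟨(j, b), mem_univ _, hb⟩))
    refine ih (c + 1) (Fin.cons g f) ?_ ?_ ?_ ?_ fun w hw => h w (mem_insert_of_mem hw)
    · intro j
      cases j using Fin.cases with
      | zero => simpa using hginj
      | succ j => simpa using hinj j
    · intro j
      cases j using Fin.cases with
      | zero => simpa using hgadj
      | succ j => simpa using hadj j
    · intro j j' hjj'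
      cases j using Fin.cases with
      | zero =>
        cases j' using Fin.cases with
        | zero => exact absurd rfl hjj'
        | succ j' => simpa using hgf j'
      | succ j =>
        cases j' using Fin.cases with
        | zero => simpa using (hgf j).symm
        | succ j' => simpa using hdisj fun heq => hjj' (congrArg Fin.succ heq)
    · intro j i
      cases j using Fin.cases with
      | zero => exact fun hmem => hgS i (mem_union_left _ hmem)
      | succ j => exact fun hmem => hT j i (mem_insert_of_mem hmem)

/-- For sufficiently large `n`: if an `n`-vertex graph has no `ℓ+1` pairwise
vertex-disjoint copies of `C_{2k+1}` and `L` is a set of `ℓ` vertices each lying in at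
least `n²/(8ℓ(2k+1))` triangles, then `G − L` is `C_{2k+1}`-free. -/
theorem stmt_17 (ℓ k : ℕ) (hℓ : 1 ≤ ℓ) (hk : 1 ≤ k) :
    ∃ n₀ : ℕ, ∀ n : ℕ, n₀ ≤ n →
      ∀ (V : Type) [Fintype V] (G : SimpleGraph V), Fintype.card V = n →
        ¬ HasDisjointCycles G (ℓ + 1) (2 * k + 1) →
        ∀ L : Set V, L.ncard = ℓ →
          (∀ v ∈ L, (n : ℝ) ^ 2 / (8 * ℓ * (2 * k + 1)) ≤
              ({t ∈ G.cliqueSet 3 | v ∈ t}.ncard : ℝ)) →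
          ¬ Contains (G.induce Lᶜ) (cycleGraph (2 * k + 1)) := by
  classical
  set K : ℕ := 4 * k + 2 * ((1 + ℓ) * (2 * k + 1)) with hK
  refine ⟨K * (8 * ℓ * (2 * k + 1)) + 1, ?_⟩
  rintro n hn V _ G hcard hfree L hL htri ⟨f, hf, hfadj⟩
  have hLcard : L.toFinset.card = ℓ := by rw [← Set.ncard_eq_toFinset_card', hL]
  apply hfree
  rw [← hLcard, add_comm]
  refine hasDisjointCycles_add_card G k hk L.toFinset 1 (fun _ i => (f i : V))
    (fun _ => Subtype.val_injective.comp hf) (fun _ _ _ hij => hfadj hij)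
    (fun j j' hjj' => absurd (Subsingleton.elim j j') hjj')
    (fun _ i hi => (f i).2 (Set.mem_toFinset.1 hi)) ?_
  intro v hv
  rw [hLcard, ← hK, hcard]
  have hv' := htri v (by simpa using hv)
  have hD : (0 : ℝ) < 8 * ℓ * (2 * k + 1) := by
    have : (1 : ℝ) ≤ ℓ := by exact_mod_cast hℓ
    positivity
  have hn' : (K : ℝ) * (8 * ℓ * (2 * k + 1)) + 1 ≤ n := by exact_mod_cast hn
  have hlt : ((K * n : ℕ) : ℝ) < (n : ℝ) ^ 2 / (8 * ℓ * (2 * k + 1)) := by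
    rw [lt_div_iff₀ hD]
    push_cast
    have hnpos : (0 : ℝ) < n := by
      have : (0 : ℝ) ≤ K * (8 * ℓ * (2 * k + 1)) := by positivity
      linarith
    nlinarith
  exact_mod_cast hlt.trans_le hv'
end

section
/- For all integers ℓ ≥ 1 and k ≥ 1 there exists n₀ such that for all n ≥ n₀: if G is a graph on n vertices and L ⊆ V(G) with |L| = ℓ is such that the induced subgraph on S = V(G) ∖ L is C_{2k+1}-free, then the number of triangles of G satisfies t(G) ≤ ℓ·⌊(n−ℓ)²/4⌋ + (n−ℓ)·C(ℓ,2) + C(ℓ,3). -/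
open SimpleGraph

section CliqueCounting

variable {V : Type*} (G : SimpleGraph V) [DecidableRel G.Adj]

/-- The neighbours of `x` inside `U`. -/
def nbrsIn (U : Finset V) (x : V) : Finset V := {y ∈ U | G.Adj x y}

variable {G}

@[simp]
lemma mem_nbrsIn {U : Finset V} {x y : V} : y ∈ nbrsIn G U x ↔ y ∈ U ∧ G.Adj x y := by
  simp [nbrsIn]

lemma nbrsIn_subset (U : Finset V) (x : V) : nbrsIn G U x ⊆ U := Finset.filter_subset _ _

variable (G) in
/-- The neighbours of `v` in `U` that lie in a triangle with `v` inside `U`. -/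
def triangleNbrsIn (U : Finset V) (v : V) : Finset V :=
  {a ∈ nbrsIn G U v | ∃ b ∈ nbrsIn G U v, G.Adj a b}

lemma mem_triangleNbrsIn {U : Finset V} {v a b : V} (ha : a ∈ nbrsIn G U v)
    (hb : b ∈ nbrsIn G U v) (hab : G.Adj a b) : a ∈ triangleNbrsIn G U v :=
  Finset.mem_filter.2 ⟨ha, b, hb, hab⟩

variable [DecidableEq V]

variable (G) in
/-- The number of cliques of size `j` of `G` inside the vertex set `U`. -/
def cliqueCountOn (j : ℕ) (U : Finset V) : ℕ :=
  ((U.powersetCard j).filter fun s : Finset V => G.IsClique (s : Set V)).card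

lemma cliqueCountOn_one (U : Finset V) : cliqueCountOn G 1 U = U.card := by
  unfold cliqueCountOn
  rw [Finset.filter_true_of_mem, Finset.card_powersetCard, Nat.choose_one_right]
  intro s hs
  obtain ⟨x, rfl⟩ := Finset.card_eq_one.1 (Finset.mem_powersetCard.1 hs).2
  simp

lemma cliqueCountOn_le_choose (j : ℕ) (U : Finset V) :
    cliqueCountOn G j U ≤ U.card.choose j :=
  (Finset.card_filter_le _ _).trans (Finset.card_powersetCard _ _).le

lemma cliqueCountOn_mono (j : ℕ) {U W : Finset V} (h : U ⊆ W) :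
    cliqueCountOn G j U ≤ cliqueCountOn G j W :=
  Finset.card_le_card (Finset.filter_subset_filter _ (Finset.powersetCard_mono h))

/-- Splitting the cliques of `U ∪ {x}` by whether they contain `x`. -/
lemma cliqueCountOn_insert (j : ℕ) {U : Finset V} {x : V} (hx : x ∉ U) :
    cliqueCountOn G (j + 1) (insert x U) =
      cliqueCountOn G (j + 1) U + cliqueCountOn G j (nbrsIn G U x) := by
  unfold cliqueCountOn
  rw [Finset.powersetCard_succ_insert hx, Finset.filter_union, Finset.card_union_of_disjoint]
  · congr 1
    symm
    refine Finset.card_bij (fun s _ => insert x s) ?_ ?_ ?_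
    · intro s hs
      simp only [Finset.mem_filter, Finset.mem_powersetCard, Finset.mem_image] at hs ⊢
      refine ⟨⟨s, ⟨hs.1.1.trans (nbrsIn_subset _ _), hs.1.2⟩, rfl⟩, ?_⟩
      rw [Finset.coe_insert, SimpleGraph.isClique_insert]
      exact ⟨hs.2, fun y hy _ => (mem_nbrsIn.1 (hs.1.1 hy)).2⟩
    · intro s hs t ht hst
      simp only [Finset.mem_filter, Finset.mem_powersetCard] at hs ht
      have h1 : x ∉ s := fun h => hx (nbrsIn_subset _ _ (hs.1.1 h))
      have h2 : x ∉ t := fun h => hx (nbrsIn_subset _ _ (ht.1.1 h))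
      rw [← Finset.erase_insert h1, ← Finset.erase_insert h2, hst]
    · intro t ht
      simp only [Finset.mem_filter, Finset.mem_powersetCard, Finset.mem_image] at ht
      obtain ⟨⟨s, ⟨hs, hc⟩, rfl⟩, ht⟩ := ht
      rw [Finset.coe_insert, SimpleGraph.isClique_insert] at ht
      refine ⟨s, ?_, rfl⟩
      simp only [Finset.mem_filter, Finset.mem_powersetCard]
      exact ⟨⟨fun y hy => mem_nbrsIn.2 ⟨hs hy, ht.2 y hy (fun h => hx (h ▸ hs hy))⟩, hc⟩, ht.1⟩
  · rw [Finset.disjoint_left]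
    intro s hs ht
    simp only [Finset.mem_filter, Finset.mem_powersetCard, Finset.mem_image] at hs ht
    obtain ⟨⟨t, -, rfl⟩, -⟩ := ht
    exact hx (hs.1.1 (Finset.mem_insert_self _ _))

lemma nbrsIn_erase (U : Finset V) (x : V) : nbrsIn G (U.erase x) x = nbrsIn G U x := by
  ext y
  simp only [mem_nbrsIn, Finset.mem_erase]
  exact ⟨fun h => ⟨h.1.2, h.2⟩, fun h => ⟨⟨h.2.ne', h.1⟩, h.2⟩⟩

lemma cliqueCountOn_erase (j : ℕ) {U : Finset V} {x : V} (hx : x ∈ U) :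
    cliqueCountOn G (j + 1) U =
      cliqueCountOn G (j + 1) (U.erase x) + cliqueCountOn G j (nbrsIn G U x) := by
  conv_lhs => rw [← Finset.insert_erase hx, cliqueCountOn_insert j (Finset.notMem_erase x U)]
  rw [nbrsIn_erase]

/-- Mantel's theorem, for the graph induced on `U`. -/
lemma cliqueCountOn_two_le_of_triangleFree (U : Finset V)
    (h : ∀ x ∈ U, ∀ y ∈ U, ∀ z ∈ U, G.Adj x y → G.Adj x z → ¬ G.Adj y z) :
    cliqueCountOn G 2 U ≤ U.card ^ 2 / 4 := by
  induction U using Finset.strongInduction with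
  | H U ih =>
    by_cases hE : ∃ x ∈ U, ∃ y ∈ U, G.Adj x y
    · obtain ⟨x, hx, y, hy, hxy⟩ := hE
      have hy' : y ∈ U.erase x := Finset.mem_erase.2 ⟨hxy.ne', hy⟩
      have hsub : (U.erase x).erase y ⊂ U :=
        (Finset.erase_ssubset hy').trans (Finset.erase_ssubset hx)
      have hi := ih _ hsub fun a ha b hb c hc =>
        h a (hsub.1 ha) b (hsub.1 hb) c (hsub.1 hc)
      have e1 := cliqueCountOn_erase (G := G) 1 hx
      have e2 := cliqueCountOn_erase (G := G) 1 hy'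
      simp only [Nat.reduceAdd, cliqueCountOn_one] at e1 e2
      have c1 := Finset.card_erase_of_mem hx
      have c2 := Finset.card_erase_of_mem hy'
      have p1 : 0 < (U.erase x).card := Finset.card_pos.2 ⟨y, hy'⟩
      have hd : Disjoint (nbrsIn G U x) (nbrsIn G (U.erase x) y) := by
        rw [Finset.disjoint_left]
        intro z hz hz'
        rw [mem_nbrsIn] at hz hz'
        exact h x hx y hy z hz.1 hxy hz.2 hz'.2
      have hcard : (nbrsIn G U x).card + (nbrsIn G (U.erase x) y).card ≤ (U.erase x).card := by
        rw [← Finset.card_union_of_disjoint hd]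
        refine Finset.card_le_card (Finset.union_subset ?_ (nbrsIn_subset _ _))
        rw [← nbrsIn_erase]
        exact nbrsIn_subset _ _
      obtain ⟨m, hm⟩ : ∃ m, U.card = m + 2 := ⟨U.card - 2, by omega⟩
      have h3 : ((U.erase x).erase y).card = m := by omega
      rw [h3] at hi
      rw [hm]
      have : (m + 2) ^ 2 = m ^ 2 + 4 * (m + 1) := by ring
      omega
    · push Not at hE
      have : cliqueCountOn G 2 U = 0 := by
        unfold cliqueCountOn
        rw [Finset.card_eq_zero, Finset.filter_eq_empty_iff]
        intro s hs hc
        rw [Finset.mem_powersetCard] at hs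
        obtain ⟨a, b, hab, rfl⟩ := Finset.card_eq_two.1 hs.2
        exact hE a (hs.1 (by simp)) b (hs.1 (by simp)) (hc (by simp) (by simp) hab)
      omega

lemma cliqueCountOn_three_eq_zero (U : Finset V)
    (h : ∀ x ∈ U, ∀ y ∈ U, ∀ z ∈ U, G.Adj x y → G.Adj x z → ¬ G.Adj y z) :
    cliqueCountOn G 3 U = 0 := by
  unfold cliqueCountOn
  rw [Finset.card_eq_zero, Finset.filter_eq_empty_iff]
  intro s hs hc
  rw [Finset.mem_powersetCard] at hs
  obtain ⟨a, b, c, hab, hac, hbc, rfl⟩ := Finset.card_eq_three.1 hs.2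
  exact h a (hs.1 (by simp)) b (hs.1 (by simp)) c (hs.1 (by simp))
    (hc (by simp) (by simp) hab) (hc (by simp) (by simp) hac) (hc (by simp) (by simp) hbc)

/-- Adding a set `L` of vertices to `S` creates few edges and triangles. -/
lemma cliqueCountOn_union_le (S L : Finset V) (hd : Disjoint S L) :
    cliqueCountOn G 2 (S ∪ L) ≤
        cliqueCountOn G 2 S + L.card * S.card + L.card.choose 2 ∧
      cliqueCountOn G 3 (S ∪ L) ≤
        cliqueCountOn G 3 S + L.card * cliqueCountOn G 2 S + S.card * L.card.choose 2 +
          L.card.choose 3 := by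
  induction L using Finset.induction_on with
  | empty => simp
  | insert x L hx ih =>
    rw [Finset.disjoint_insert_right] at hd
    obtain ⟨ih2, ih3⟩ := ih hd.2
    have hx' : x ∉ S ∪ L := by simp [hx, hd.1]
    rw [Finset.union_insert, cliqueCountOn_insert 1 hx', cliqueCountOn_insert 2 hx',
      cliqueCountOn_one, Finset.card_insert_of_notMem hx]
    have h1 : (nbrsIn G (S ∪ L) x).card ≤ S.card + L.card :=
      (Finset.card_le_card (nbrsIn_subset _ _)).trans (Finset.card_union_le _ _)
    have h2 := cliqueCountOn_mono (G := G) 2 (nbrsIn_subset (G := G) (S ∪ L) x)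
    have c2 : (L.card + 1).choose 2 = L.card + L.card.choose 2 := by
      rw [Nat.choose_succ_succ', Nat.choose_one_right]
    have c3 : (L.card + 1).choose 3 = L.card.choose 2 + L.card.choose 3 :=
      Nat.choose_succ_succ' _ _
    rw [c2, c3]
    constructor <;> nlinarith

end CliqueCounting

section CycleFree

variable {V : Type*} (G : SimpleGraph V)

/-- `G` has no cycle of length `m` inside `U`; cycles are given by the list of their vertices. -/
def IsCycleFreeOn (m : ℕ) (U : Finset V) : Prop :=
  ∀ l : List V, l.length = m → (∀ x ∈ l, x ∈ U) → l.Nodup → l.IsChain G.Adj →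
    ∀ x ∈ l.head?, ∀ y ∈ l.getLast?, ¬ G.Adj x y

variable {G}

lemma IsCycleFreeOn.mono {m : ℕ} {U W : Finset V} (h : IsCycleFreeOn G m W) (hUW : U ⊆ W) :
    IsCycleFreeOn G m U :=
  fun l hl hU => h l hl fun x hx => hUW (hU x hx)

lemma isCycleFreeOn_of_not_contains {m : ℕ} (hm : 2 ≤ m) {S : Finset V} {L : Set V}
    (hS : ∀ x ∈ S, x ∉ L) (h : ¬ Contains (G.induce Lᶜ) (cycleGraph m)) :
    IsCycleFreeOn G m S := by
  intro l hl hU hnd hch x hx y hy hadj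
  subst hl
  have key : ∀ i j : Fin l.length, (j - i).val = 1 → G.Adj l[i] l[j] := by
    intro i j hij
    rcases le_or_gt i j with hle | hlt
    · rw [Fin.sub_val_of_le hle] at hij
      have hj : j.val = i.val + 1 := by omega
      have := List.isChain_iff_getElem.1 hch i.val (by omega)
      simpa [hj] using this
    · rw [Fin.coe_sub_iff_lt.2 hlt] at hij
      have hj : j.val = 0 := by omega
      have hi : i.val = l.length - 1 := by omega
      have h0 : l ≠ [] := by rintro rfl; simp at hm
      rw [List.head?_eq_some_head h0, Option.mem_some_iff] at hx
      rw [List.getLast?_eq_some_getLast h0, Option.mem_some_iff] at hy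
      subst hx hy
      have e1 : l[i] = l.getLast h0 := by simp [List.getLast_eq_getElem, hi]
      have e2 : l[j] = l.head h0 := by simp [List.head_eq_getElem, hj]
      rw [e1, e2]
      exact hadj.symm
  refine h ⟨fun i => ⟨l[i], hS _ (hU _ (List.getElem_mem _))⟩, ?_, ?_⟩
  · intro i j hij
    have : l[i.val] = l[j.val] := congrArg Subtype.val hij
    exact Fin.ext ((hnd.getElem_inj_iff).1 this)
  · intro i j hij
    rw [cycleGraph_adj'] at hij
    rcases hij with hij | hij
    · exact (key j i hij).symm
    · exact key i j hij

variable [DecidableEq V] [DecidableRel G.Adj]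

lemma exists_path_of_le_degree {U : Finset V} (hU : U.Nonempty) {r : ℕ}
    (hdeg : ∀ u ∈ U, r ≤ (nbrsIn G U u).card) (i : ℕ) (hi : i < r) :
    ∃ l : List V, l.length = i + 1 ∧ (∀ x ∈ l, x ∈ U) ∧ l.Nodup ∧ l.IsChain G.Adj := by
  induction i with
  | zero =>
    obtain ⟨u, hu⟩ := hU
    exact ⟨[u], by simp, by simpa using hu, by simp, by simp⟩
  | succ i ih =>
    obtain ⟨l, hl, hlU, hnd, hch⟩ := ih (by omega)
    obtain ⟨x, t, rfl⟩ : ∃ x t, l = x :: t := List.exists_cons_of_length_eq_add_one hl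
    have hcard : (x :: t).toFinset.card < (nbrsIn G U x).card :=
      calc (x :: t).toFinset.card ≤ i + 1 := hl ▸ List.toFinset_card_le _
        _ < r := hi
        _ ≤ _ := hdeg x (hlU x (by simp))
    obtain ⟨y, hy, hyl⟩ := Finset.exists_mem_notMem_of_card_lt_card hcard
    rw [mem_nbrsIn] at hy
    rw [List.mem_toFinset] at hyl
    refine ⟨y :: x :: t, by simpa using hl, ?_, List.nodup_cons.2 ⟨hyl, hnd⟩,
      List.isChain_cons_cons.2 ⟨hy.2.symm, hch⟩⟩
    intro z hz
    rcases List.mem_cons.1 hz with rfl | hz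
    · exact hy.1
    · exact hlU z hz

/-- A graph without a path on `r` vertices has at most `r` times as many edges as vertices. -/
lemma cliqueCountOn_two_le_of_no_path {r : ℕ} (hr : 1 ≤ r) (U : Finset V)
    (h : ∀ l : List V, l.length = r → (∀ x ∈ l, x ∈ U) → l.Nodup → ¬ l.IsChain G.Adj) :
    cliqueCountOn G 2 U ≤ r * U.card := by
  induction U using Finset.strongInduction with
  | H U ih =>
    rcases U.eq_empty_or_nonempty with rfl | hU
    · simpa using cliqueCountOn_le_choose (G := G) 2 (∅ : Finset V)
    · have hex : ∃ u ∈ U, (nbrsIn G U u).card < r := by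
        by_contra! hcon
        obtain ⟨l, hl, hlU, hnd, hch⟩ := exists_path_of_le_degree hU hcon (r - 1) (by omega)
        exact h l (by omega) hlU hnd hch
      obtain ⟨u, hu, hur⟩ := hex
      have hi := ih _ (Finset.erase_ssubset hu) fun l hl hlU =>
        h l hl fun x hx => Finset.mem_of_mem_erase (hlU x hx)
      rw [cliqueCountOn_erase 1 hu, cliqueCountOn_one, ← Finset.card_erase_add_one hu]
      nlinarith

lemma IsCycleFreeOn.cliqueCountOn_nbrsIn_le {r : ℕ} (hr : 1 ≤ r) {U : Finset V}
    (hC : IsCycleFreeOn G (r + 1) U) {v : V} (hv : v ∈ U) :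
    cliqueCountOn G 2 (nbrsIn G U v) ≤ r * (nbrsIn G U v).card := by
  refine cliqueCountOn_two_le_of_no_path hr _ fun l hl hlU hnd hch => ?_
  have h0 : l ≠ [] := by rintro rfl; simp at hl; omega
  have hvl : v ∉ l := fun hvl => (mem_nbrsIn.1 (hlU v hvl)).2.ne rfl
  refine hC (v :: l) (by simp [hl]) ?_ (List.nodup_cons.2 ⟨hvl, hnd⟩)
    (List.isChain_cons.2 ⟨fun y hy => ?_, hch⟩) v (by simp) (l.getLast h0) ?_ ?_
  · intro z hz
    rcases List.mem_cons.1 hz with rfl | hz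
    · exact hv
    · exact (mem_nbrsIn.1 (hlU z hz)).1
  · exact (mem_nbrsIn.1 (hlU y (List.mem_of_mem_head? hy))).2
  · rw [List.getLast?_cons_of_ne_nil h0]
    exact List.getLast?_eq_some_getLast h0
  · exact (mem_nbrsIn.1 (hlU _ (List.getLast_mem h0))).2

/-- If every vertex of the set `A` of bounded size has linearly many neighbours in the large set
`U`, then there is a large complete bipartite graph between `A` and `U`. -/
lemma exists_completeBipartite {A U : Finset V} {Q t s : ℕ} (hQ : 0 < Q)
    (hA : A.card = 2 * Q * t) (hdeg : ∀ a ∈ A, U.card ≤ Q * (nbrsIn G U a).card)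
    (hU : 2 ^ A.card * s * A.card < t * U.card) :
    ∃ B ⊆ A, ∃ Y ⊆ U, t ≤ B.card ∧ s < Y.card ∧ ∀ b ∈ B, ∀ y ∈ Y, G.Adj b y := by
  have hdc : ∑ a ∈ A, (nbrsIn G U a).card = ∑ y ∈ U, (nbrsIn G A y).card := by
    have := Finset.sum_card_bipartiteAbove_eq_sum_card_bipartiteBelow (s := A) (t := U) G.Adj
    simpa only [Finset.bipartiteAbove, Finset.bipartiteBelow, nbrsIn, G.adj_comm] using this
  have hlow : 2 * t * U.card ≤ ∑ a ∈ A, (nbrsIn G U a).card := by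
    have h1 : ∑ _a ∈ A, U.card ≤ ∑ a ∈ A, Q * (nbrsIn G U a).card := Finset.sum_le_sum hdeg
    rw [Finset.sum_const, smul_eq_mul, hA, ← Finset.mul_sum] at h1
    refine Nat.le_of_mul_le_mul_left ?_ hQ
    calc Q * (2 * t * U.card) = 2 * Q * t * U.card := by ring
      _ ≤ _ := h1
  set Y₀ : Finset V := {y ∈ U | t ≤ (nbrsIn G A y).card} with hY₀
  have hup : ∑ y ∈ U, (nbrsIn G A y).card ≤ Y₀.card * A.card + t * U.card := by
    calc ∑ y ∈ U, (nbrsIn G A y).card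
        ≤ ∑ y ∈ U, ((if t ≤ (nbrsIn G A y).card then A.card else 0) + t) := by
          refine Finset.sum_le_sum fun y _ => ?_
          split_ifs with hy
          · exact (Finset.card_le_card (nbrsIn_subset _ _)).trans (Nat.le_add_right _ _)
          · omega
      _ = Y₀.card * A.card + t * U.card := by
          rw [Finset.sum_add_distrib, ← Finset.sum_filter, Finset.sum_const, Finset.sum_const,
            smul_eq_mul, smul_eq_mul, mul_comm U.card]
  have hYcard : 2 ^ A.card * s < Y₀.card := by
    refine lt_of_mul_lt_mul_right ?_ (Nat.zero_le A.card)
    nlinarith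
  rw [← Finset.card_powerset] at hYcard
  obtain ⟨B, hB, hfib⟩ := Finset.exists_lt_card_fiber_of_mul_lt_card_of_maps_to
    (f := fun y => nbrsIn G A y) (fun y _ => Finset.mem_powerset.2 (nbrsIn_subset A y)) hYcard
  refine ⟨B, Finset.mem_powerset.1 hB, {y ∈ Y₀ | nbrsIn G A y = B},
    (Finset.filter_subset _ _).trans (Finset.filter_subset _ _), ?_, hfib, ?_⟩
  · obtain ⟨y, hy⟩ := Finset.card_pos.1 (Nat.zero_lt_of_lt hfib)
    simp only [hY₀, Finset.mem_filter] at hy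
    exact hy.2 ▸ hy.1.2
  · intro b hb y hy
    rw [← (Finset.mem_filter.1 hy).2] at hb
    exact (mem_nbrsIn.1 hb).2.symm

/-- A complete bipartite graph between a set `B` of neighbours of `v`, each of which lies in a
triangle with `v`, and a set `Y` yields an odd cycle that alternates between `B` and `Y`. -/
lemma IsCycleFreeOn.false_of_completeBipartite {k : ℕ} (hk : 1 ≤ k) {U : Finset V}
    (hC : IsCycleFreeOn G (2 * k + 1) U) {v : V} (hv : v ∈ U) {B Y : Finset V}
    (hBv : B ⊆ nbrsIn G U v) (hYU : Y ⊆ U) (hB : 2 * k + 1 < B.card) (hY : 2 * k + 1 < Y.card)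
    (hBY : ∀ b ∈ B, ∀ y ∈ Y, G.Adj b y)
    (htri : ∀ b ∈ B, ∃ c ∈ nbrsIn G U v, G.Adj b c) : False := by
  have key : ∀ j, j + 1 ≤ k → ∃ (x : V) (l : List V), (x :: l).length = 2 * j + 3 ∧ x ∈ B ∧
      (∀ z ∈ x :: l, z ∈ U) ∧ (x :: l).Nodup ∧ (x :: l).IsChain G.Adj ∧
      (x :: l).getLast? = some v := by
    intro j
    induction j with
    | zero =>
      intro _
      obtain ⟨b, hb⟩ := Finset.card_pos.1 (Nat.zero_lt_of_lt hB)
      obtain ⟨c, hc, hbc⟩ := htri b hb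
      have hb' := mem_nbrsIn.1 (hBv hb)
      rw [mem_nbrsIn] at hc
      refine ⟨b, [c, v], by simp, hb, ?_, ?_, ?_, by simp⟩
      · simp [hb'.1, hc.1, hv]
      · simp [hbc.ne, hb'.2.ne', hc.2.ne']
      · simp [hbc, hc.2.symm]
    | succ j ih =>
      intro hj
      obtain ⟨x, l, hl, hx, hlU, hnd, hch, hlast⟩ := ih (by omega)
      have hcard : (x :: l).toFinset.card ≤ 2 * j + 3 := hl ▸ List.toFinset_card_le _
      obtain ⟨y, hy, hyl⟩ := Finset.exists_mem_notMem_of_card_lt_card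
        (show (x :: l).toFinset.card < Y.card by omega)
      obtain ⟨b, hb, hbl⟩ := Finset.exists_mem_notMem_of_card_lt_card
        (show (x :: l).toFinset.card < B.card by omega)
      rw [List.mem_toFinset] at hyl hbl
      refine ⟨b, y :: x :: l, ?_, hb, ?_, ?_, ?_, ?_⟩
      · simp only [List.length_cons] at hl ⊢
        omega
      · intro z hz
        rcases List.mem_cons.1 hz with rfl | hz
        · exact (mem_nbrsIn.1 (hBv hb)).1
        · rcases List.mem_cons.1 hz with rfl | hz
          · exact hYU hy
          · exact hlU z hz
      · refine List.nodup_cons.2 ⟨?_, List.nodup_cons.2 ⟨hyl, hnd⟩⟩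
        rw [List.mem_cons, not_or]
        exact ⟨(hBY b hb y hy).ne, hbl⟩
      · exact List.isChain_cons_cons.2
          ⟨hBY b hb y hy, List.isChain_cons_cons.2 ⟨(hBY x hx y hy).symm, hch⟩⟩
      · rw [List.getLast?_cons_cons, List.getLast?_cons_cons, hlast]
  obtain ⟨x, l, hl, hx, hlU, hnd, hch, hlast⟩ := key (k - 1) (by omega)
  exact hC (x :: l) (by omega) hlU hnd hch x (by simp) v hlast
    (mem_nbrsIn.1 (hBv hx)).2.symm

lemma IsCycleFreeOn.card_triangleNbrsIn_lt {k Q R : ℕ} (hk : 1 ≤ k) (hQ : 0 < Q) {U : Finset V}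
    (hC : IsCycleFreeOn G (2 * k + 1) U) (hR : R = 2 * Q * (2 * k + 2))
    (hdeg : ∀ a ∈ U, U.card ≤ Q * (nbrsIn G U a).card)
    (hU : 2 ^ R * (2 * k + 1) * R < (2 * k + 2) * U.card) {v : V} (hv : v ∈ U) :
    (triangleNbrsIn G U v).card < R := by
  by_contra! hcon
  obtain ⟨A, hA, hAR⟩ := Finset.exists_subset_card_eq hcon
  have hAN : A ⊆ nbrsIn G U v := hA.trans (Finset.filter_subset _ _)
  obtain ⟨B, hBA, Y, hYU, hB, hY, hBY⟩ := exists_completeBipartite (s := 2 * k + 1) hQ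
    (hAR.trans hR) (fun a ha => hdeg a (nbrsIn_subset _ _ (hAN ha))) (by rwa [hAR])
  exact hC.false_of_completeBipartite hk hv (hBA.trans hAN) hYU hB hY hBY
    fun b hb => (Finset.mem_filter.1 (hA (hBA hb))).2

lemma cliqueCountOn_nbrsIn_le_sq (U : Finset V) (v : V) :
    cliqueCountOn G 2 (nbrsIn G U v) ≤ (triangleNbrsIn G U v).card ^ 2 := by
  refine le_trans ?_ ((cliqueCountOn_le_choose (G := G) 2 _).trans (Nat.choose_le_pow _ _))
  refine Finset.card_le_card fun s hs => ?_
  rw [Finset.mem_filter, Finset.mem_powersetCard] at hs ⊢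
  refine ⟨⟨fun a ha => ?_, hs.1.2⟩, hs.2⟩
  obtain ⟨b, hb, hne⟩ := Finset.exists_mem_ne (by omega : 1 < s.card) a
  exact mem_triangleNbrsIn (hs.1.1 ha) (hs.1.1 hb) (hs.2 ha hb hne.symm)

/-- A Bonferroni inequality for three subsets of `U`. -/
lemma card_add_card_add_card_le {U A B C : Finset V} (hA : A ⊆ U) (hB : B ⊆ U) (hC : C ⊆ U) :
    A.card + B.card + C.card ≤
      U.card + (A ∩ B).card + (A ∩ C).card + (B ∩ C).card := by
  have h1 := Finset.card_union_add_card_inter A B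
  have h2 := Finset.card_union_add_card_inter (A ∪ B) C
  have h3 : ((A ∪ B) ∩ C).card ≤ (A ∩ C).card + (B ∩ C).card := by
    rw [Finset.union_inter_distrib_right]
    exact Finset.card_union_le _ _
  have h4 : (A ∪ B ∪ C).card ≤ U.card :=
    Finset.card_le_card (Finset.union_subset (Finset.union_subset hA hB) hC)
  omega

/-- The extremal bound under a minimum degree condition. -/
lemma IsCycleFreeOn.edges_add_triangles_le_of_min {k R : ℕ} (hk : 1 ≤ k) {U : Finset V}
    (hC : IsCycleFreeOn G (2 * k + 1) U) (hR : R = 2 * (4 * k + 3) * (2 * k + 2))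
    (hU : 2 ^ R * (2 * k + 1) * R < U.card) (hU' : 6 * (R ^ 2 + R + 2) < U.card)
    (hmin : ∀ v ∈ U, U.card / 2 ≤
      (nbrsIn G U v).card + cliqueCountOn G 2 (nbrsIn G U v)) :
    cliqueCountOn G 2 U + cliqueCountOn G 3 U ≤ U.card ^ 2 / 4 := by
  have hdeg : ∀ a ∈ U, U.card ≤ (4 * k + 3) * (nbrsIn G U a).card := by
    intro a ha
    have h1 := hC.cliqueCountOn_nbrsIn_le (by omega) ha
    have h2 := hmin a ha
    have h3 : U.card ≤ 2 * ((2 * k + 1) * (nbrsIn G U a).card) + 1 := by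
      have : (2 * k + 1) * (nbrsIn G U a).card =
        2 * k * (nbrsIn G U a).card + (nbrsIn G U a).card := by ring
      omega
    have h4 : 0 < (nbrsIn G U a).card := by
      by_contra! h0
      rw [Nat.le_zero.1 h0] at h3
      omega
    nlinarith
  have htri : ∀ v ∈ U, (triangleNbrsIn G U v).card < R := fun v hv =>
    hC.card_triangleNbrsIn_lt hk (by omega) hR hdeg (by nlinarith) hv
  have hhalf : ∀ v ∈ U, U.card / 2 ≤ (nbrsIn G U v).card + R ^ 2 := fun v hv =>
    (hmin v hv).trans (Nat.add_le_add_left ((cliqueCountOn_nbrsIn_le_sq U v).trans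
      (Nat.pow_le_pow_left (htri v hv).le 2)) _)
  have hcodeg : ∀ x ∈ U, ∀ y ∈ U, G.Adj x y → (nbrsIn G U x ∩ nbrsIn G U y).card < R := by
    intro x hx y hy hxy
    refine lt_of_le_of_lt (Finset.card_le_card fun z hz => ?_) (htri x hx)
    rw [Finset.mem_inter, mem_nbrsIn, mem_nbrsIn] at hz
    exact mem_triangleNbrsIn (mem_nbrsIn.2 hz.1) (mem_nbrsIn.2 ⟨hy, hxy⟩) hz.2.2.symm
  have hfree : ∀ x ∈ U, ∀ y ∈ U, ∀ z ∈ U, G.Adj x y → G.Adj x z → ¬ G.Adj y z := by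
    intro x hx y hy z hz hxy hxz hyz
    have h1 := card_add_card_add_card_le (nbrsIn_subset (G := G) U x)
      (nbrsIn_subset (G := G) U y) (nbrsIn_subset (G := G) U z)
    have h2 := hcodeg x hx y hy hxy
    have h3 := hcodeg x hx z hz hxz
    have h4 := hcodeg y hy z hz hyz
    have h5 := hhalf x hx
    have h6 := hhalf y hy
    have h7 := hhalf z hz
    omega
  rw [cliqueCountOn_three_eq_zero U hfree, add_zero]
  exact cliqueCountOn_two_le_of_triangleFree U hfree

/-- Either the extremal bound holds, or the excess over it is controlled by `M - |U|`. -/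
lemma IsCycleFreeOn.edges_add_triangles_le_or {k R m M : ℕ} (hk : 1 ≤ k)
    (hR : R = 2 * (4 * k + 3) * (2 * k + 2))
    (hm : m = 2 ^ R * (2 * k + 1) * R + 6 * (R ^ 2 + R + 2)) (hM : M = m + m ^ 2 + m ^ 3)
    (U : Finset V) (hC : IsCycleFreeOn G (2 * k + 1) U) :
    cliqueCountOn G 2 U + cliqueCountOn G 3 U ≤ U.card ^ 2 / 4 ∨
      cliqueCountOn G 2 U + cliqueCountOn G 3 U + U.card ≤ U.card ^ 2 / 4 + M := by
  induction U using Finset.strongInduction with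
  | H U ih =>
    by_cases hUm : U.card ≤ m
    · right
      have h2 := (cliqueCountOn_le_choose (G := G) 2 U).trans (Nat.choose_le_pow _ _)
      have h3 := (cliqueCountOn_le_choose (G := G) 3 U).trans (Nat.choose_le_pow _ _)
      have h4 := Nat.pow_le_pow_left hUm 2
      have h5 := Nat.pow_le_pow_left hUm 3
      omega
    by_cases hmin : ∀ v ∈ U, U.card / 2 ≤
        (nbrsIn G U v).card + cliqueCountOn G 2 (nbrsIn G U v)
    · exact Or.inl (hC.edges_add_triangles_le_of_min hk hR (by omega) (by omega) hmin)
    push Not at hmin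
    obtain ⟨v, hv, hlt⟩ := hmin
    have hi := ih _ (Finset.erase_ssubset hv) (hC.mono (Finset.erase_subset _ _))
    have hc := Finset.card_erase_add_one hv
    rw [cliqueCountOn_erase 1 hv, cliqueCountOn_erase 2 hv, cliqueCountOn_one]
    simp only [Nat.reduceAdd]
    rw [← hc] at hlt ⊢
    generalize (U.erase v).card = c at *
    have hstep : (c + 1) ^ 2 / 4 = c ^ 2 / 4 + (c + 1) / 2 := by
      obtain ⟨d, rfl | rfl⟩ := Nat.even_or_odd' c
      · have e1 : (2 * d + 1) ^ 2 = 4 * (d ^ 2 + d) + 1 := by ring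
        have e2 : (2 * d) ^ 2 = 4 * d ^ 2 := by ring
        omega
      · have e1 : (2 * d + 1 + 1) ^ 2 = 4 * (d ^ 2 + 2 * d + 1) := by ring
        have e2 : (2 * d + 1) ^ 2 = 4 * (d ^ 2 + d) + 1 := by ring
        omega
    omega

end CycleFree

lemma triangleCount_eq_cliqueCountOn_univ {V : Type*} [Fintype V] [DecidableEq V]
    (G : SimpleGraph V) [DecidableRel G.Adj] :
    triangleCount G = cliqueCountOn G 3 Finset.univ := by
  unfold triangleCount cliqueCountOn
  rw [← Set.ncard_coe_finset]
  congr 1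
  ext s
  simp [SimpleGraph.mem_cliqueSet_iff, SimpleGraph.isNClique_iff, and_comm]

/-- For sufficiently large `n`: if `L` is a set of `ℓ` vertices of an `n`-vertex graph `G`
such that the induced subgraph on `V(G) ∖ L` is `C_{2k+1}`-free, then
`t(G) ≤ ℓ·⌊(n−ℓ)²/4⌋ + (n−ℓ)·C(ℓ,2) + C(ℓ,3)`. -/
theorem stmt_19 (ℓ k : ℕ) (hℓ : 1 ≤ ℓ) (hk : 1 ≤ k) :
    ∃ n₀ : ℕ, ∀ n : ℕ, n₀ ≤ n →
      ∀ (V : Type) [Fintype V] (G : SimpleGraph V), Fintype.card V = n →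
        ∀ L : Set V, L.ncard = ℓ →
          ¬ Contains (G.induce Lᶜ) (cycleGraph (2 * k + 1)) →
          triangleCount G ≤
            ℓ * ((n - ℓ) ^ 2 / 4) + (n - ℓ) * Nat.choose ℓ 2 + Nat.choose ℓ 3 := by
  obtain ⟨R, hR⟩ : ∃ R, R = 2 * (4 * k + 3) * (2 * k + 2) := ⟨_, rfl⟩
  obtain ⟨m, hm⟩ : ∃ m, m = 2 ^ R * (2 * k + 1) * R + 6 * (R ^ 2 + R + 2) := ⟨_, rfl⟩
  obtain ⟨M, hM⟩ : ∃ M, M = m + m ^ 2 + m ^ 3 := ⟨_, rfl⟩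
  refine ⟨M + ℓ, fun n hn V _ G hV L hL hfree => ?_⟩
  classical
  have hLcard : L.toFinset.card = ℓ := by rw [← Set.ncard_eq_toFinset_card', hL]
  have hScard : (L.toFinsetᶜ).card = n - ℓ := by rw [Finset.card_compl, hV, hLcard]
  have hC : IsCycleFreeOn G (2 * k + 1) L.toFinsetᶜ :=
    isCycleFreeOn_of_not_contains (by omega) (by simp) hfree
  have hS : cliqueCountOn G 2 L.toFinsetᶜ + cliqueCountOn G 3 L.toFinsetᶜ ≤ (n - ℓ) ^ 2 / 4 := by
    have := hC.edges_add_triangles_le_or hk hR hm hM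
    rw [hScard] at this
    omega
  have hT := (cliqueCountOn_union_le (G := G) L.toFinsetᶜ L.toFinset disjoint_compl_left).2
  rw [Finset.union_comm, Finset.union_compl, hLcard, hScard] at hT
  rw [triangleCount_eq_cliqueCountOn_univ]
  have hmul := Nat.mul_le_mul_left ℓ hS
  have h3 := Nat.mul_le_mul_right (cliqueCountOn G 3 L.toFinsetᶜ) hℓ
  rw [mul_add] at hmul
  omega
end
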